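/- Let $w \in S_n$ commute with the order-reversing permutation $w_0$, and let $w = s_{i_1}\cdots s_{i_m}$ be a reduced (minimal length) factorization in terms of the type-B generators $s_i$ ($s_i = (i,i+1)(n-i,n-i+1)$ for $i < \lfloor n/2\rfloor$, and $s_k = (k,k+1)$ if $n = 2k$, $s_k = (k,k+2)$ if $n = 2k+1$). Then the number of inversions of $w$ equals the sum of the numbers of inversions of the factors: $\mathrm{inv}(w) = \sum_{j=1}^m \mathrm{inv}(s_{i_j})$. -/

import Mathlib

/-- The type-B/C generators of the centralizer of the order-reversing permutation
(0-indexed positions): `s_i = (i,i+1)(n-i,n-i+1)` for `i < n/2`, and `s_k = (k,k+1)`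
if `n = 2k`, `s_k = (k,k+2)` if `n = 2k+1`, where `k = ⌊n/2⌋`. -/
def genBC (n : ℕ) (i : ℕ) : Equiv.Perm (Fin n) :=
  if h : 1 ≤ i ∧ i ≤ n / 2 then
    if hik : i < n / 2 then
      Equiv.swap ⟨i - 1, by omega⟩ ⟨i, by omega⟩ *
        Equiv.swap ⟨n - i - 1, by omega⟩ ⟨n - i, by omega⟩
    else if hpar : n % 2 = 0 then
      Equiv.swap ⟨n / 2 - 1, by omega⟩ ⟨n / 2, by omega⟩
    else Equiv.swap ⟨n / 2 - 1, by omega⟩ ⟨n / 2 + 1, by omega⟩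
  else 1

/-- The number of inversions of a permutation. -/
def invCount {n : ℕ} (w : Equiv.Perm (Fin n)) : ℕ :=
  (Finset.univ.filter fun p : Fin n × Fin n => p.1 < p.2 ∧ w p.2 < w p.1).card

open Equiv

/-- The smaller position of the simple root attached to the generator `genBC n i`. -/
def rootFst (n i : ℕ) (h : 1 ≤ i ∧ i ≤ n / 2) : Fin n := ⟨i - 1, by omega⟩

/-- The larger position of the simple root attached to the generator `genBC n i`. -/
def rootSnd (n i : ℕ) (h : 1 ≤ i ∧ i ≤ n / 2) : Fin n :=
  ⟨if i < n / 2 then i else n - i, by split_ifs <;> omega⟩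

/-- The signed reflection exchanging `a` with `b` and `rev a` with `rev b`. -/
def reflFun {n : ℕ} (a b x : Fin n) : Fin n :=
  if x = a then b else if x = b then a else
    if x = a.rev then b.rev else if x = b.rev then a.rev else x

theorem swap_val {n : ℕ} (a b x : Fin n) :
    (swap a b x : ℕ) = if (x : ℕ) = a then (b : ℕ) else if (x : ℕ) = b then (a : ℕ) else x := by
  simp only [swap_apply_def, Fin.ext_iff]
  split_ifs <;> rfl

theorem genBC_val {n i : ℕ} (h : 1 ≤ i ∧ i ≤ n / 2) (x : Fin n) :
    (genBC n i x : ℕ) =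
      if (x : ℕ) = i - 1 then (rootSnd n i h : ℕ)
      else if (x : ℕ) = rootSnd n i h then i - 1
      else if (x : ℕ) = n - i then n - 1 - rootSnd n i h
      else if (x : ℕ) = n - 1 - rootSnd n i h then n - i
      else x := by
  unfold genBC rootSnd
  rw [dif_pos h]
  by_cases hi : i < n / 2
  · simp only [dif_pos hi, if_pos hi]
    rw [Perm.mul_apply]
    generalize hy : swap (_ : Fin n) _ x = y
    have h₁ := congrArg Fin.val hy
    rw [swap_val] at h₁
    rw [swap_val]
    simp only at h₁ ⊢
    split_ifs at h₁ ⊢ <;> omega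
  · simp only [dif_neg hi, if_neg hi]
    by_cases hpar : n % 2 = 0
    · rw [dif_pos hpar, swap_val]
      simp only
      split_ifs <;> omega
    · rw [dif_neg hpar, swap_val]
      simp only
      split_ifs <;> omega

theorem genBC_apply {n i : ℕ} (h : 1 ≤ i ∧ i ≤ n / 2) (x : Fin n) :
    genBC n i x = reflFun (rootFst n i h) (rootSnd n i h) x := by
  have h₁ := genBC_val h x
  have h₂ := (rootSnd n i h).isLt
  unfold reflFun
  simp only [Fin.ext_iff, Fin.val_rev, rootFst]
  split_ifs at h₁ ⊢ <;> (try simp only [Fin.val_rev]) <;> omega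

theorem apply_reflFun {n : ℕ} (t : Perm (Fin n)) (ht : ∀ x, t x.rev = (t x).rev)
    (a b x : Fin n) : t (reflFun a b x) = reflFun (t a) (t b) (t x) := by
  unfold reflFun
  simp only [← ht, t.injective.eq_iff]
  split_ifs <;> rfl

theorem reflFun_rev_rev {n : ℕ} {a b : Fin n} (ha : a ≠ a.rev) (hb : b ≠ b.rev) (x : Fin n) :
    reflFun b.rev a.rev x = reflFun a b x := by
  unfold reflFun
  simp only [Fin.rev_rev]
  split_ifs <;> simp_all

theorem genBC_rev {n i : ℕ} (h : 1 ≤ i ∧ i ≤ n / 2) (x : Fin n) :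
    genBC n i x.rev = (genBC n i x).rev := by
  have h₁ := genBC_val h x
  have h₂ := genBC_val h x.rev
  have h₃ : (rootSnd n i h : ℕ) = if i < n / 2 then i else n - i := rfl
  rw [Fin.ext_iff, Fin.val_rev]
  rw [Fin.val_rev] at h₂
  split_ifs at h₁ h₂ h₃ <;> omega

theorem genBC_mul_self {n i : ℕ} (h : 1 ≤ i ∧ i ≤ n / 2) : genBC n i * genBC n i = 1 := by
  ext x
  rw [Perm.mul_apply, Perm.one_apply]
  have h₁ := genBC_val h x
  have h₂ := genBC_val h (genBC n i x)
  have h₃ : (rootSnd n i h : ℕ) = if i < n / 2 then i else n - i := rfl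
  split_ifs at h₁ h₂ h₃ <;> omega

theorem rootFst_ne_rev {n i : ℕ} (h : 1 ≤ i ∧ i ≤ n / 2) :
    rootFst n i h ≠ (rootFst n i h).rev := by
  simp only [rootFst, ne_eq, Fin.ext_iff, Fin.val_rev]
  omega

theorem rootSnd_ne_rev {n i : ℕ} (h : 1 ≤ i ∧ i ≤ n / 2) :
    rootSnd n i h ≠ (rootSnd n i h).rev := by
  simp only [rootSnd, ne_eq, Fin.ext_iff, Fin.val_rev]
  split_ifs <;> omega

theorem rootFst_lt_rootSnd {n i : ℕ} (h : 1 ≤ i ∧ i ≤ n / 2) :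
    rootFst n i h < rootSnd n i h := by
  simp only [rootFst, rootSnd, Fin.lt_def]
  split_ifs <;> omega

/-- The inversions of a generator: its simple root, the mirror image of that root, and, for the
last generator in odd rank, the two pairs involving the middle position. -/
theorem genBC_inversion {n i : ℕ} (h : 1 ≤ i ∧ i ≤ n / 2) {x y : Fin n} (hxy : x < y)
    (hs : genBC n i y < genBC n i x) :
    (x = rootFst n i h ∧ y = rootSnd n i h) ∨
    (x = (rootSnd n i h).rev ∧ y = (rootFst n i h).rev) ∨
    (rootSnd n i h = (rootFst n i h).rev ∧
      ((x = rootFst n i h ∧ y = y.rev) ∨ (x = x.rev ∧ y = rootSnd n i h))) := by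
  have h₁ := genBC_val h x
  have h₂ := genBC_val h y
  by_cases hi : i < n / 2 <;>
  · simp only [rootFst, rootSnd, Fin.ext_iff, Fin.val_rev, Fin.lt_def, hi, ↓reduceIte]
      at h₁ h₂ hxy hs ⊢
    split_ifs at h₁ h₂ <;> first
      | (exfalso; omega)
      | (left; constructor <;> omega)
      | (right; left; constructor <;> omega)
      | (right; right; refine ⟨by omega, Or.inl ⟨?_, ?_⟩⟩ <;> omega)
      | (right; right; refine ⟨by omega, Or.inr ⟨?_, ?_⟩⟩ <;> omega)

theorem prod_genBC_rev {n : ℕ} (l : List ℕ) (hl : ∀ i ∈ l, 1 ≤ i ∧ i ≤ n / 2) (x : Fin n) :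
    (l.map (genBC n)).prod x.rev = ((l.map (genBC n)).prod x).rev := by
  induction l with
  | nil => rfl
  | cons j l ih =>
    simp only [List.map_cons, List.prod_cons, Perm.mul_apply]
    rw [ih fun i hi => hl i (by simp [hi]), genBC_rev (hl j (by simp))]

/-- The exchange condition for the generators `genBC`. -/
theorem exists_shorter_word {n i : ℕ} (h : 1 ≤ i ∧ i ≤ n / 2) (l : List ℕ)
    (hl : ∀ j ∈ l, 1 ≤ j ∧ j ≤ n / 2)
    (hlt : (l.map (genBC n)).prod (rootSnd n i h) < (l.map (genBC n)).prod (rootFst n i h)) :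
    ∃ l' : List ℕ, (∀ j ∈ l', 1 ≤ j ∧ j ≤ n / 2) ∧ l'.length < l.length ∧
      (l.map (genBC n)).prod * genBC n i = (l'.map (genBC n)).prod := by
  induction l with
  | nil => exact absurd hlt (rootFst_lt_rootSnd h).not_gt
  | cons j l ih =>
    have hj := hl j (by simp)
    have hl₀ : ∀ k ∈ l, 1 ≤ k ∧ k ≤ n / 2 := fun k hk => hl k (by simp [hk])
    have ht := prod_genBC_rev l hl₀
    simp only [List.map_cons, List.prod_cons, Perm.mul_apply] at hlt ⊢
    set t := (l.map (genBC n)).prod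
    rcases lt_or_ge (t (rootSnd n i h)) (t (rootFst n i h)) with hlt' | hge
    · obtain ⟨l', hl', hlen, hprod⟩ := ih hl₀ hlt'
      refine ⟨j :: l', ?_, by simpa using hlen, ?_⟩
      · simpa using ⟨hj, hl'⟩
      · rw [mul_assoc, hprod, List.map_cons, List.prod_cons]
    · refine ⟨l, hl₀, by simp, ?_⟩
      have hne : t (rootFst n i h) < t (rootSnd n i h) :=
        lt_of_le_of_ne hge (t.injective.ne (rootFst_lt_rootSnd h).ne)
      have ha : t (rootFst n i h) ≠ (t (rootFst n i h)).rev := by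
        rw [← ht]; exact t.injective.ne (rootFst_ne_rev h)
      have hb : t (rootSnd n i h) ≠ (t (rootSnd n i h)).rev := by
        rw [← ht]; exact t.injective.ne (rootSnd_ne_rev h)
      have hconj : t * genBC n i = genBC n j * t := by
        refine Equiv.ext fun x => ?_
        rw [Perm.mul_apply, Perm.mul_apply, genBC_apply h, genBC_apply hj, apply_reflFun t ht]
        rcases genBC_inversion hj hne hlt with ⟨h₁, h₂⟩ | ⟨h₁, h₂⟩ | ⟨-, ⟨-, h₂⟩ | ⟨h₁, -⟩⟩
        · rw [h₁, h₂]
        · rw [h₁, h₂, reflFun_rev_rev (rootFst_ne_rev hj) (rootSnd_ne_rev hj)]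
        · exact absurd h₂ hb
        · exact absurd h₁ ha
      rw [mul_assoc, hconj, ← mul_assoc, genBC_mul_self hj, one_mul]

/-- Inversion numbers add when every inversion of `v` remains an inversion of `u * v`. -/
theorem invCount_mul {n : ℕ} (u v : Perm (Fin n))
    (huv : ∀ x y, x < y → v y < v x → u (v y) < u (v x)) :
    invCount (u * v) = invCount u + invCount v := by
  unfold invCount
  rw [← Finset.card_filter_add_card_filter_not (fun p : Fin n × Fin n => v p.1 < v p.2)]
  congr 1
  · refine Finset.card_equiv (v.prodCongr v) fun p => ?_
    simp only [Finset.mem_filter, Finset.mem_univ, true_and, prodCongr_apply,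
      Prod.map_fst, Prod.map_snd]
    simp only [Perm.mul_apply]
    refine ⟨fun hp => ⟨hp.2, hp.1.2⟩, fun hp => ⟨⟨?_, hp.2⟩, hp.1⟩⟩
    by_contra hle
    rcases (not_lt.mp hle).lt_or_eq with hlt | heq
    · exact (huv _ _ hlt hp.1).not_gt hp.2
    · rw [heq] at hp
      exact hp.1.false
  · congr 1
    ext p
    simp only [Finset.mem_filter, Finset.mem_univ, true_and]
    simp only [Perm.mul_apply]
    refine ⟨fun hp => ⟨hp.1.1, lt_of_le_of_ne (not_lt.mp hp.2) (v.injective.ne hp.1.1.ne')⟩,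
      fun hp => ⟨⟨hp.1, huv _ _ hp.1 hp.2⟩, hp.2.not_gt⟩⟩

theorem invCount_mul_genBC {n i : ℕ} (h : 1 ≤ i ∧ i ≤ n / 2) (u : Perm (Fin n))
    (hu : ∀ x, u x.rev = (u x).rev) (hlt : u (rootFst n i h) < u (rootSnd n i h)) :
    invCount (u * genBC n i) = invCount u + invCount (genBC n i) := by
  refine invCount_mul u _ fun x y hxy hs => ?_
  have hfst : genBC n i (rootFst n i h) = rootSnd n i h := by simp [genBC_apply h, reflFun]
  have hsnd : genBC n i (rootSnd n i h) = rootFst n i h := by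
    simp [genBC_apply h, reflFun, (rootFst_lt_rootSnd h).ne']
  have hmid : ∀ z : Fin n, z = z.rev → genBC n i z = z := by
    intro z hz
    have h₁ := rootFst_ne_rev h
    have h₂ := rootSnd_ne_rev h
    rw [genBC_apply h, reflFun, if_neg, if_neg, if_neg, if_neg]
    all_goals
      rintro rfl
      first
        | exact h₁ hz
        | exact h₂ hz
        | exact h₁ (by simpa using hz.symm)
        | exact h₂ (by simpa using hz.symm)
  have hval : ∀ z : Fin n, z = z.rev → u z = (u z).rev := fun z hz => by rw [← hu, ← hz]
  rcases genBC_inversion h hxy hs with ⟨rfl, rfl⟩ | ⟨rfl, rfl⟩ | ⟨hr, ⟨rfl, hy⟩ | ⟨hx, rfl⟩⟩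
  · rwa [hfst, hsnd]
  · rwa [genBC_rev h, genBC_rev h, hfst, hsnd, hu, hu, Fin.rev_lt_rev]
  · rw [hmid y hy, hfst]
    have h₁ := hval y hy
    rw [hr, hu] at hlt ⊢
    simp only [Fin.ext_iff, Fin.lt_def, Fin.val_rev] at *
    omega
  · rw [hmid x hx, hsnd]
    have h₁ := hval x hx
    rw [hr, hu] at hlt
    simp only [Fin.ext_iff, Fin.lt_def, Fin.val_rev] at *
    omega

theorem invCount_prod_of_reduced {n : ℕ} (l : List ℕ) (hl : ∀ i ∈ l, 1 ≤ i ∧ i ≤ n / 2)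
    (hred : ∀ l' : List ℕ, (∀ i ∈ l', 1 ≤ i ∧ i ≤ n / 2) →
      (l.map (genBC n)).prod = (l'.map (genBC n)).prod → l.length ≤ l'.length) :
    invCount (l.map (genBC n)).prod = (l.map fun i => invCount (genBC n i)).sum := by
  induction l using List.reverseRecOn with
  | nil =>
    simp only [List.map_nil, List.prod_nil, List.sum_nil, invCount, Perm.one_apply,
      Finset.card_eq_zero, Finset.filter_eq_empty_iff]
    exact fun p _ hp => hp.1.not_gt hp.2
  | append_singleton l i ih =>
    have hi := hl i (by simp)
    have hl₀ : ∀ k ∈ l, 1 ≤ k ∧ k ≤ n / 2 := fun k hk => hl k (by simp [hk])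
    simp only [List.map_append, List.map_cons, List.map_nil, List.prod_append, List.sum_append,
      List.prod_singleton, List.sum_singleton, List.length_append, List.length_singleton] at hred ⊢
    rw [invCount_mul_genBC hi _ (prod_genBC_rev l hl₀), ih hl₀]
    · intro l' hl' heq
      have := hred (l' ++ [i]) (by
        intro k hk
        rcases List.mem_append.mp hk with hk | hk
        · exact hl' k hk
        · rw [List.mem_singleton.mp hk]; exact hi) (by simp [heq])
      simpa using this
    · by_contra hle
      have hlt := lt_of_le_of_ne (not_lt.mp hle)
        ((l.map (genBC n)).prod.injective.ne (rootFst_lt_rootSnd hi).ne')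
      obtain ⟨l', hl', hlen, hprod⟩ := exists_shorter_word hi l hl₀ hlt
      have := hred l' hl' hprod
      omega

/-- If `w` commutes with the order-reversing permutation and `w = s_{i₁} ⋯ s_{i_m}`
is a reduced (minimal length) factorization in the type-B/C generators, then
`inv(w) = ∑_j inv(s_{i_j})`. -/
theorem stmt_16 (n : ℕ) (w : Equiv.Perm (Fin n))
    (hw : w * Fin.revPerm = Fin.revPerm * w)
    (l : List ℕ) (hl : ∀ i ∈ l, 1 ≤ i ∧ i ≤ n / 2)
    (hfac : w = (l.map (genBC n)).prod)
    (hred : ∀ l' : List ℕ, (∀ i ∈ l', 1 ≤ i ∧ i ≤ n / 2) →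
      w = (l'.map (genBC n)).prod → l.length ≤ l'.length) :
    invCount w = (l.map fun i => invCount (genBC n i)).sum := by
  subst hfac
  exact invCount_prod_of_reduced l hl hred
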